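/- Let Q_0 = -7(u_0^2 - 3u_1^2) + 6u_2^2 + 6u_2u_3 - 6u_3u_4 and Q_∞ = 14u_0u_1 + u_2^2 - 2u_2u_4 - 3u_3^2 - u_4^2 (the forms defining the surface X_{-7}). Then for every field K equipped with a ℚ-algebra structure of dimension at most 2 over ℚ, there is no nonzero vector x ∈ K^5 with Q_0(x) = 0 and Q_∞(x) = 0. (That is, the quartic del Pezzo surface X_{-7} has no closed points of degree 1 or 2.) -/

import Mathlib

/-- The quadratic form `Q₀ = -7(u₀² - 3u₁²) + 6u₂² + 6u₂u₃ - 6u₃u₄` (the case `d = -7`). -/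
def Q0 {F : Type*} [Field F] (u : Fin 5 → F) : F :=
  -7 * (u 0 ^ 2 - 3 * u 1 ^ 2) + 6 * u 2 ^ 2 + 6 * u 2 * u 3 - 6 * u 3 * u 4

/-- The quadratic form `Q∞ = 14u₀u₁ + u₂² - 2u₂u₄ - 3u₃² - u₄²` (the case `d = -7`). -/
def Qinf {F : Type*} [Field F] (u : Fin 5 → F) : F :=
  14 * u 0 * u 1 + u 2 ^ 2 - 2 * u 2 * u 4 - 3 * u 3 ^ 2 - u 4 ^ 2

open Matrix

/-- The vectors `v` and `w` span a totally isotropic subspace for the bilinear form of `M`. -/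
def IsotropicPair {n : ℕ} (M : Matrix (Fin n) (Fin n) ℤ) (v w : Fin n → ℤ) : Prop :=
  v ⬝ᵥ M *ᵥ v = 0 ∧ v ⬝ᵥ M *ᵥ w = 0 ∧ w ⬝ᵥ M *ᵥ v = 0 ∧ w ⬝ᵥ M *ᵥ w = 0

theorem IsotropicPair.swap {n : ℕ} {M : Matrix (Fin n) (Fin n) ℤ} {v w : Fin n → ℤ}
    (h : IsotropicPair M v w) : IsotropicPair M w v :=
  ⟨h.2.2.2, h.2.2.1, h.2.1, h.1⟩

theorem IsotropicPair.combination_self {n : ℕ} {M : Matrix (Fin n) (Fin n) ℤ} {v w : Fin n → ℤ}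
    (h : IsotropicPair M v w) (s t : ℤ) :
    (s • v + t • w) ⬝ᵥ M *ᵥ (s • v + t • w) = 0 := by
  obtain ⟨h1, h2, h3, h4⟩ := h
  simp [-zsmul_eq_mul, mulVec_add, mulVec_smul, h1, h2, h3, h4]

/-- Replace `w` by `(w + s v) / p`. -/
theorem IsotropicPair.of_smul_eq {n : ℕ} {M : Matrix (Fin n) (Fin n) ℤ} {v w w' : Fin n → ℤ}
    {p s : ℤ} (hp : p ≠ 0) (h : IsotropicPair M v w) (hw : p • w' = w + s • v) :
    IsotropicPair M v w' := by
  obtain ⟨h1, h2, h3, h4⟩ := h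
  refine ⟨h1, ?_, ?_, ?_⟩
  · have : p * (v ⬝ᵥ M *ᵥ w') = 0 := by
      rw [← smul_eq_mul, ← dotProduct_smul, ← mulVec_smul, hw]
      simp [-zsmul_eq_mul, mulVec_add, mulVec_smul, h1, h2]
    simpa [hp] using this
  · have : p * (w' ⬝ᵥ M *ᵥ v) = 0 := by
      rw [← smul_eq_mul, ← smul_dotProduct, hw]
      simp [-zsmul_eq_mul, h1, h3]
    simpa [hp] using this
  · have : p * (p * (w' ⬝ᵥ M *ᵥ w')) = 0 := by
      rw [← smul_eq_mul p (w' ⬝ᵥ _), ← smul_dotProduct, ← smul_eq_mul, ← dotProduct_smul,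
        ← mulVec_smul, hw]
      simp [-zsmul_eq_mul, mulVec_add, mulVec_smul, h1, h2, h3, h4]
    simpa [hp] using this

/-- An isotropic plane has a basis which stays independent modulo `p`. -/
theorem IsotropicPair.exists_not_dvd_minor {n : ℕ} {M : Matrix (Fin n) (Fin n) ℤ} {p : ℕ}
    (hp : p.Prime) {v w : Fin n → ℤ} (h : IsotropicPair M v w) {i j : Fin n}
    (hij : v i * w j - v j * w i ≠ 0) :
    ∃ v' w' : Fin n → ℤ, IsotropicPair M v' w' ∧
      ∃ k l, ¬ (p : ℤ) ∣ v' k * w' l - v' l * w' k := by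
  have hp0 : (p : ℤ) ≠ 0 := by exact_mod_cast hp.ne_zero
  have hpp : Prime (p : ℤ) := Nat.prime_iff_prime_int.mp hp
  induction hm : (v i * w j - v j * w i).natAbs using Nat.strong_induction_on generalizing v w with
  | _ m ih =>
  subst hm
  by_cases hall : ∃ k l, ¬ (p : ℤ) ∣ v k * w l - v l * w k
  · exact ⟨v, w, h, hall⟩
  push Not at hall
  have step : ∀ v' w' : Fin n → ℤ, IsotropicPair M v' w' →
      p * (v' i * w' j - v' j * w' i) = v i * w j - v j * w i →
      ∃ v' w' : Fin n → ℤ, IsotropicPair M v' w' ∧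
      ∃ k l, ¬ (p : ℤ) ∣ v' k * w' l - v' l * w' k := by
    intro v' w' hiso heq
    have hne : v' i * w' j - v' j * w' i ≠ 0 := by
      intro h0
      rw [h0, mul_zero] at heq
      exact hij heq.symm
    refine ih _ ?_ hiso hne rfl
    rw [← heq, Int.natAbs_mul, Int.natAbs_natCast]
    exact lt_mul_of_one_lt_left (Int.natAbs_pos.mpr hne) hp.one_lt
  by_cases hv : ∀ k, (p : ℤ) ∣ v k
  · choose v' hv' using hv
    have hvv : (p : ℤ) • v' = v + (0 : ℤ) • w := by
      ext k; simp [hv']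
    refine step v' w (h.swap.of_smul_eq hp0 hvv).swap ?_
    rw [hv' i, hv' j]; ring
  · push Not at hv
    obtain ⟨k, hk⟩ := hv
    obtain ⟨x, y, hxy⟩ : IsCoprime (v k) (p : ℤ) :=
      ((Prime.coprime_iff_not_dvd hpp).mpr hk).symm
    have hw : ∀ l, (p : ℤ) ∣ w l + (-(x * w k)) * v l := by
      intro l
      have h1 : w l + (-(x * w k)) * v l = x * (v k * w l - v l * w k) + p * (y * w l) := by
        linear_combination (-w l) * hxy
      rw [h1]
      exact dvd_add ((hall k l).mul_left _) (dvd_mul_right _ _)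
    choose w' hw' using hw
    refine step v w' (h.of_smul_eq hp0 (s := -(x * w k)) ?_) ?_
    · ext l; simp [← hw' l]
    · linear_combination v j * hw' i - v i * hw' j

theorem det_eq_mul_of_zero_block {R : Type*} [CommRing R] (G : Matrix (Fin 4) (Fin 4) R)
    (h00 : G 0 0 = 0) (h01 : G 0 1 = 0) (h10 : G 1 0 = 0) (h11 : G 1 1 = 0) :
    G.det = (G 0 2 * G 1 3 - G 0 3 * G 1 2) * (G 2 0 * G 3 1 - G 3 0 * G 2 1) := by
  rw [Matrix.det_succ_row_zero]
  simp [Fin.sum_univ_succ, Matrix.det_fin_three, Fin.succAbove, h00, h01, h10, h11]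
  ring

theorem exists_det_ne_zero_of_minor_ne_zero {F : Type*} [Field F] {v w : Fin 4 → F} {i j : Fin 4}
    (hij : v i * w j - v j * w i ≠ 0) :
    ∃ k l, (Matrix.of ![v, w, Pi.single k 1, Pi.single l 1]).det ≠ 0 := by
  by_contra! h
  apply hij
  have h01 := h 0 1
  have h02 := h 0 2
  have h03 := h 0 3
  have h12 := h 1 2
  have h13 := h 1 3
  have h23 := h 2 3
  rw [Matrix.det_succ_row_zero] at h01 h02 h03 h12 h13 h23
  simp [Fin.sum_univ_succ, Matrix.det_fin_three, Fin.succAbove] at h01 h02 h03 h12 h13 h23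
  clear h hij
  fin_cases i <;> fin_cases j <;> simp <;> grind

/-- A four-dimensional quadratic space containing an isotropic plane has square discriminant. -/
theorem isSquare_det_of_isotropic {F : Type*} [Field F] {A : Matrix (Fin 4) (Fin 4) F}
    (hA : A.IsSymm) {v w : Fin 4 → F} {i j : Fin 4} (hij : v i * w j - v j * w i ≠ 0)
    (hvv : v ⬝ᵥ A *ᵥ v = 0) (hvw : v ⬝ᵥ A *ᵥ w = 0) (hww : w ⬝ᵥ A *ᵥ w = 0) :
    IsSquare A.det := by
  obtain ⟨k, l, hkl⟩ := exists_det_ne_zero_of_minor_ne_zero hij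
  set P : Matrix (Fin 4) (Fin 4) F := Matrix.of ![v, w, Pi.single k 1, Pi.single l 1] with hP
  set G := P * A * Pᵀ with hG
  have hGs : G.IsSymm := by
    simp [hG, Matrix.IsSymm, Matrix.transpose_mul, hA.eq, Matrix.mul_assoc]
  have hent : ∀ r s, G r s = P r ⬝ᵥ A *ᵥ P s := by
    intro r s
    rw [hG, Matrix.mul_assoc, Matrix.mul_apply]
    rfl
  have h00 : G 0 0 = 0 := by rw [hent]; exact hvv
  have h01 : G 0 1 = 0 := by rw [hent]; exact hvw
  have h10 : G 1 0 = 0 := by rw [hGs.apply, h01]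
  have h11 : G 1 1 = 0 := by rw [hent]; exact hww
  have hdet := det_eq_mul_of_zero_block G h00 h01 h10 h11
  rw [hGs.apply 0 2, hGs.apply 1 3, hGs.apply 0 3, hGs.apply 1 2] at hdet
  have h2 : G.det = P.det * P.det * A.det := by
    rw [hG, Matrix.det_mul, Matrix.det_mul, Matrix.det_transpose]; ring
  refine ⟨(G 0 2 * G 1 3 - G 0 3 * G 1 2) / P.det, ?_⟩
  field_simp
  linear_combination hdet - h2

/-- A nondegenerate ternary quadratic space contains no isotropic plane. -/
theorem det_eq_zero_of_isotropic {F : Type*} [Field F] {A : Matrix (Fin 3) (Fin 3) F}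
    (hA : A.IsSymm) {v w : Fin 3 → F} {i j : Fin 3} (hij : v i * w j - v j * w i ≠ 0)
    (hvv : v ⬝ᵥ A *ᵥ v = 0) (hvw : v ⬝ᵥ A *ᵥ w = 0) (hww : w ⬝ᵥ A *ᵥ w = 0) :
    A.det = 0 := by
  obtain ⟨k, hk⟩ : ∃ k, (Matrix.of ![v, w, Pi.single k 1]).det ≠ 0 := by
    by_contra! h
    apply hij
    have h0 := h 0
    have h1 := h 1
    have h2 := h 2
    simp [Matrix.det_fin_three] at h0 h1 h2
    clear h hij
    fin_cases i <;> fin_cases j <;> simp <;> grind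
  set P : Matrix (Fin 3) (Fin 3) F := Matrix.of ![v, w, Pi.single k 1] with hP
  set G := P * A * Pᵀ with hG
  have hGs : G.IsSymm := by
    simp [hG, Matrix.IsSymm, Matrix.transpose_mul, hA.eq, Matrix.mul_assoc]
  have hent : ∀ r s, G r s = P r ⬝ᵥ A *ᵥ P s := by
    intro r s
    rw [hG, Matrix.mul_assoc, Matrix.mul_apply]
    rfl
  have h00 : G 0 0 = 0 := by rw [hent]; exact hvv
  have h01 : G 0 1 = 0 := by rw [hent]; exact hvw
  have h10 : G 1 0 = 0 := by rw [hGs.apply, h01]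
  have h11 : G 1 1 = 0 := by rw [hent]; exact hww
  have h2 : G.det = P.det * P.det * A.det := by
    rw [hG, Matrix.det_mul, Matrix.det_mul, Matrix.det_transpose]; ring
  have h3 : G.det = 0 := by
    rw [Matrix.det_fin_three, h00, h01, h10, h11]; ring
  rw [h3] at h2
  simpa [hk] using h2.symm


/-- Suppose `M` reduces modulo the odd prime `p` to a form with radical spanned by the last
coordinate, where it takes a value of valuation one. If `M` has an isotropic plane, then the
leading four-dimensional block has square discriminant modulo `p`. -/
theorem IsotropicPair.isSquare_det {p : ℕ} [Fact p.Prime] {M : Matrix (Fin 5) (Fin 5) ℤ}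
    (hM : M.IsSymm) (hrow : ∀ i, (p : ℤ) ∣ M i 4) (hlast : ¬ (p : ℤ) ^ 2 ∣ M 4 4)
    {v w : Fin 5 → ℤ} (h : IsotropicPair M v w) {i j : Fin 5} (hij : v i * w j - v j * w i ≠ 0) :
    IsSquare (((M.submatrix Fin.castSucc Fin.castSucc).map (Int.cast : ℤ → ZMod p)).det) := by
  have hp : p.Prime := Fact.out
  have hpp : Prime (p : ℤ) := Nat.prime_iff_prime_int.mp hp
  obtain ⟨v, w, h, k, l, hkl⟩ := h.exists_not_dvd_minor hp hij
  have hcol : ∀ i, ((M i 4 : ℤ) : ZMod p) = 0 := fun i =>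
    (ZMod.intCast_zmod_eq_zero_iff_dvd _ _).mpr (hrow i)
  have hrow' : ∀ i, ((M 4 i : ℤ) : ZMod p) = 0 := fun i => by rw [hM.apply]; exact hcol i
  set A := (M.submatrix Fin.castSucc Fin.castSucc).map (Int.cast : ℤ → ZMod p) with hA
  set red : (Fin 5 → ℤ) → Fin 4 → ZMod p := fun x r => ((x r.castSucc : ℤ) : ZMod p) with hred
  have hform : ∀ x y : Fin 5 → ℤ, x ⬝ᵥ M *ᵥ y = 0 → red x ⬝ᵥ A *ᵥ red y = 0 := by
    intro x y hxy
    have h1 : ((x ⬝ᵥ M *ᵥ y : ℤ) : ZMod p) = 0 := by rw [hxy]; simp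
    rw [← h1]
    simp only [dotProduct, mulVec, hA, hred, Fin.sum_univ_castSucc (n := 4)]
    have e : Fin.last 4 = 4 := rfl
    simp [e, hcol, hrow']
  by_cases hmin : ∃ r s : Fin 4, red v r * red w s - red v s * red w r ≠ 0
  · obtain ⟨r, s, hrs⟩ := hmin
    exact isSquare_det_of_isotropic (hM.submatrix _ |>.map _) hrs (hform _ _ h.1)
      (hform _ _ h.2.1) (hform _ _ h.2.2.2)
  exfalso
  push Not at hmin
  have hdvd : ∀ r s : Fin 4, (p : ℤ) ∣ v r.castSucc * w s.castSucc - v s.castSucc * w r.castSucc := by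
    intro r s
    rw [← ZMod.intCast_zmod_eq_zero_iff_dvd]
    simpa [hred] using hmin r s
  obtain ⟨r, hr⟩ : ∃ r : Fin 4, ¬ (p : ℤ) ∣ v r.castSucc * w 4 - v 4 * w r.castSucc := by
    by_contra! hc
    apply hkl
    induction k using Fin.lastCases with
    | last =>
      induction l using Fin.lastCases with
      | last => simp
      | cast l => exact (dvd_sub_comm).mp (by simpa [mul_comm] using hc l)
    | cast k =>
      induction l using Fin.lastCases with
      | last => exact hc k
      | cast l => exact hdvd k l
  set u : Fin 5 → ℤ := v r.castSucc • w + (-w r.castSucc) • v with hu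
  have huiso : u ⬝ᵥ M *ᵥ u = 0 := h.swap.combination_self _ _
  have hu4 : ¬ (p : ℤ) ∣ u 4 := by
    convert hr using 2
    simp [hu]; ring
  have hus : ∀ s : Fin 4, (p : ℤ) ∣ u s.castSucc := by
    intro s
    convert hdvd r s using 1
    simp [hu]; ring
  have key : (p : ℤ) ^ 2 ∣ M 4 4 * u 4 ^ 2 := by
    choose c hc using hus
    choose d hd using hrow
    have hd' : ∀ i, M 4 i = p * d i := fun i => by rw [hM.apply]; exact hd i
    have e : Fin.last 4 = 4 := rfl
    have : M 4 4 * u 4 ^ 2 = - ((p : ℤ) ^ 2 *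
        (∑ s : Fin 4, ∑ t : Fin 4, c s * M s.castSucc t.castSucc * c t
          + 2 * ∑ s : Fin 4, c s * d s.castSucc * u 4)) := by
      simp only [dotProduct, mulVec, Fin.sum_univ_castSucc (n := 4), e, hc, hd, hd',
        Fin.sum_univ_four] at huiso ⊢
      linear_combination huiso
    rw [this]
    exact (dvd_mul_right _ _).neg_right
  exact hlast (((hpp.coprime_iff_not_dvd).mpr hu4).pow.dvd_of_dvd_mul_right key)

/-- If `T ⊥ ⟨-p⟩ ⊥ ⟨p n⟩`, with `T` ternary and unimodular at the prime `p`, has an isotropic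
plane, then `n` is a square modulo `p`. -/
theorem IsotropicPair.isSquare_of_ternary {p : ℕ} [Fact p.Prime] {M : Matrix (Fin 5) (Fin 5) ℤ}
    {n : ℤ} (hM : M.IsSymm) (h3 : ∀ i : Fin 3, M i.castSucc.castSucc 3 = 0)
    (h4 : ∀ i : Fin 3, M i.castSucc.castSucc 4 = 0) (h34 : M 3 4 = 0)
    (h33 : M 3 3 = -p) (h44 : M 4 4 = p * n)
    (hdet : ((M.submatrix (Fin.castSucc ∘ Fin.castSucc) (Fin.castSucc ∘ Fin.castSucc)).map
      (Int.cast : ℤ → ZMod p)).det ≠ 0)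
    {v w : Fin 5 → ℤ} (h : IsotropicPair M v w) {i j : Fin 5} (hij : v i * w j - v j * w i ≠ 0) :
    IsSquare (n : ZMod p) := by
  have hp : p.Prime := Fact.out
  have hpp : Prime (p : ℤ) := Nat.prime_iff_prime_int.mp hp
  obtain ⟨v, w, h, k, l, hkl⟩ := h.exists_not_dvd_minor hp hij
  have h3' : ∀ i : Fin 3, M 3 i.castSucc.castSucc = 0 := fun i => by rw [hM.apply]; exact h3 i
  have h4' : ∀ i : Fin 3, M 4 i.castSucc.castSucc = 0 := fun i => by rw [hM.apply]; exact h4 i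
  have h43 : M 4 3 = 0 := by rw [hM.apply]; exact h34
  have e4 : Fin.last 4 = 4 := rfl
  have e3 : (Fin.last 3).castSucc = 3 := rfl
  set A := (M.submatrix (Fin.castSucc ∘ Fin.castSucc) (Fin.castSucc ∘ Fin.castSucc)).map
    (Int.cast : ℤ → ZMod p) with hA
  set red : (Fin 5 → ℤ) → Fin 3 → ZMod p :=
    fun x r => ((x r.castSucc.castSucc : ℤ) : ZMod p) with hred
  have hform : ∀ x y : Fin 5 → ℤ, x ⬝ᵥ M *ᵥ y = 0 → red x ⬝ᵥ A *ᵥ red y = 0 := by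
    intro x y hxy
    have h1 : ((x ⬝ᵥ M *ᵥ y : ℤ) : ZMod p) = 0 := by rw [hxy]; simp
    rw [← h1]
    simp only [dotProduct, mulVec, hA, hred, Fin.sum_univ_castSucc (n := 4),
      Fin.sum_univ_castSucc (n := 3)]
    simp [e4, h3, h4, h3', h4', h33, h44, h34, h43]
  have hmin : ∀ r s : Fin 3, red v r * red w s - red v s * red w r = 0 := by
    by_contra! hc
    obtain ⟨r, s, hrs⟩ := hc
    exact hdet (det_eq_zero_of_isotropic (hM.submatrix _ |>.map _) hrs (hform _ _ h.1)
      (hform _ _ h.2.1) (hform _ _ h.2.2.2))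
  have hdvd : ∀ r s : Fin 3, (p : ℤ) ∣ v r.castSucc.castSucc * w s.castSucc.castSucc
      - v s.castSucc.castSucc * w r.castSucc.castSucc := by
    intro r s
    rw [← ZMod.intCast_zmod_eq_zero_iff_dvd]
    simpa [hred] using hmin r s
  obtain ⟨u, huiso, hus, t, ht⟩ : ∃ u : Fin 5 → ℤ, u ⬝ᵥ M *ᵥ u = 0 ∧
      (∀ s : Fin 3, (p : ℤ) ∣ u s.castSucc.castSucc) ∧ ∃ t, ¬ (p : ℤ) ∣ u t := by
    by_cases hv : ∀ s : Fin 3, (p : ℤ) ∣ v s.castSucc.castSucc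
    · refine ⟨v, h.1, hv, ?_⟩
      by_contra! hc
      exact hkl (dvd_sub ((hc k).mul_right _) ((hc l).mul_right _))
    · push Not at hv
      obtain ⟨r, hr⟩ := hv
      refine ⟨v r.castSucc.castSucc • w + (-w r.castSucc.castSucc) • v,
        h.swap.combination_self _ _, ?_, ?_⟩
      · intro s
        convert hdvd r s using 1
        simp; ring
      · by_contra! hc
        have h1 := dvd_sub ((hc l).mul_left (v k)) ((hc k).mul_left (v l))
        have h2 : (p : ℤ) ∣ v r.castSucc.castSucc * (v k * w l - v l * w k) := by
          refine (dvd_iff_dvd_of_dvd_sub ?_).mp h1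
          simp only [Pi.add_apply, Pi.smul_apply, smul_eq_mul]
          ring_nf
          simp
        exact (hpp.dvd_or_dvd h2).elim hr hkl
  choose c hc using hus
  have key : (p : ℤ) * (u 3 ^ 2 - n * u 4 ^ 2) =
      p * (p * ∑ r : Fin 3, ∑ s : Fin 3,
        c r * M r.castSucc.castSucc s.castSucc.castSucc * c s) := by
    simp only [dotProduct, mulVec, Fin.sum_univ_castSucc (n := 4),
      Fin.sum_univ_castSucc (n := 3), e4, e3, hc, h3, h4, h3', h4', h33, h44, h34, h43,
        Fin.sum_univ_three] at huiso ⊢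
    linear_combination -huiso
  have key2 := congrArg (Int.cast : ℤ → ZMod p) (mul_left_cancel₀ hpp.ne_zero key)
  push_cast at key2
  rw [CharP.cast_eq_zero, zero_mul, sub_eq_zero] at key2
  have hu4 : ((u 4 : ℤ) : ZMod p) ≠ 0 := by
    intro h0
    have h30 : ((u 3 : ℤ) : ZMod p) = 0 := by simpa [h0] using key2
    rw [ZMod.intCast_zmod_eq_zero_iff_dvd] at h0 h30
    apply ht
    fin_cases t
    · exact Dvd.intro _ (hc 0).symm
    · exact Dvd.intro _ (hc 1).symm
    · exact Dvd.intro _ (hc 2).symm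
    · exact h30
    · exact h0
  refine ⟨(u 3 : ZMod p) / (u 4 : ZMod p), ?_⟩
  field_simp
  exact key2.symm

theorem IsotropicPair.mulVec {n : ℕ} {M M' L : Matrix (Fin n) (Fin n) ℤ} {c : ℤ}
    (hL : Lᵀ * M' * L = c • M) {v w : Fin n → ℤ} (h : IsotropicPair M v w) :
    IsotropicPair M' (L *ᵥ v) (L *ᵥ w) := by
  have key : ∀ x y : Fin n → ℤ, (L *ᵥ x) ⬝ᵥ M' *ᵥ (L *ᵥ y) = c * (x ⬝ᵥ M *ᵥ y) := by
    intro x y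
    rw [← smul_eq_mul, ← dotProduct_smul, ← smul_mulVec, ← hL, ← mulVec_mulVec, ← mulVec_mulVec,
      dotProduct_mulVec x, vecMul_transpose]
  obtain ⟨h1, h2, h3, h4⟩ := h
  refine ⟨?_, ?_, ?_, ?_⟩ <;> rw [key] <;> simp [h1, h2, h3, h4]

theorem exists_minor_mulVec_ne_zero {n : ℕ} {L : Matrix (Fin n) (Fin n) ℤ} (hL : L.det ≠ 0)
    {v w : Fin n → ℤ} {i j : Fin n} (hij : v i * w j - v j * w i ≠ 0) :
    ∃ k l, (L *ᵥ v) k * (L *ᵥ w) l - (L *ᵥ v) l * (L *ᵥ w) k ≠ 0 := by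
  by_contra! h
  have h0 : L * (vecMulVec v w - vecMulVec w v) * Lᵀ = 0 := by
    rw [Matrix.mul_sub, Matrix.sub_mul, mul_vecMulVec, mul_vecMulVec, vecMulVec_mul, vecMulVec_mul,
      vecMul_transpose, vecMul_transpose]
    ext k l
    simp only [Matrix.sub_apply, vecMulVec_apply, Matrix.zero_apply]
    linear_combination h k l
  have h1 : L.det • L.det • (vecMulVec v w - vecMulVec w v) = 0 := by
    have h2 := congrArg (fun Z => L.adjugate * Z * Lᵀ.adjugate) h0
    simp only [Matrix.mul_zero, Matrix.zero_mul] at h2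
    rw [← h2, ← Matrix.mul_assoc, ← Matrix.mul_assoc, adjugate_mul, Matrix.mul_assoc _ Lᵀ,
      mul_adjugate, det_transpose]
    simp only [Matrix.smul_mul, Matrix.mul_smul, Matrix.one_mul, Matrix.mul_one]
  have h3 := congrFun (congrFun h1 i) j
  simp only [Matrix.smul_apply, Matrix.sub_apply, vecMulVec_apply, smul_eq_mul, Matrix.zero_apply,
    mul_eq_zero, hL, false_or] at h3
  exact hij (by linear_combination h3)

/-- The Gram matrix of `a Q₀ + b Q∞`. -/
def pencil (a b : ℤ) : Matrix (Fin 5) (Fin 5) ℤ :=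
  !![-7 * a, 7 * b, 0, 0, 0;
     7 * b, 21 * a, 0, 0, 0;
     0, 0, 6 * a + b, 3 * a, -b;
     0, 0, 3 * a, -3 * b, -3 * a;
     0, 0, -b, -3 * a, -b]

/-- The orthogonal sum `⟨e⟩ ⊥ a T ⊥ ⟨f⟩`, where `T` is the ternary part of `a Q₀ + b Q∞`. -/
def splitForm (a b e f : ℤ) : Matrix (Fin 5) (Fin 5) ℤ :=
  !![e, 0, 0, 0, 0;
     0, a * (6 * a + b), a * (3 * a), a * (-b), 0;
     0, a * (3 * a), a * (-3 * b), a * (-3 * a), 0;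
     0, a * (-b), a * (-3 * a), a * (-b), 0;
     0, 0, 0, 0, f]

theorem isSquare_of_isotropicPair_splitForm {p : ℕ} [Fact p.Prime] {a b e f : ℤ}
    (h2 : p ≠ 2) (h3 : p ≠ 3) (ha : ¬ (p : ℤ) ∣ a) (hN : (p : ℤ) ∣ b ^ 2 + 3 * a ^ 2)
    (hf : (p : ℤ) ∣ f) (hf2 : ¬ (p : ℤ) ^ 2 ∣ f) {v w : Fin 5 → ℤ}
    (h : IsotropicPair (splitForm a b e f) v w) {i j : Fin 5}
    (hij : v i * w j - v j * w i ≠ 0) : IsSquare ((-3 * e : ℤ) : ZMod p) := by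
  have hp : p.Prime := Fact.out
  have hs : (splitForm a b e f).IsSymm := by
    ext r s
    fin_cases r <;> fin_cases s <;> simp [splitForm]
  have hr : ∀ r, (p : ℤ) ∣ splitForm a b e f r 4 := by
    intro r
    fin_cases r <;> simp [splitForm, hf]
  obtain ⟨z, hz⟩ := h.isSquare_det hs hr (by simpa [splitForm] using hf2) hij
  rw [Matrix.det_succ_row_zero] at hz
  simp [Fin.sum_univ_succ, Matrix.det_fin_three, Fin.succAbove, splitForm] at hz
  have hN' : (b : ZMod p) ^ 2 + 3 * (a : ZMod p) ^ 2 = 0 := by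
    have := (ZMod.intCast_zmod_eq_zero_iff_dvd _ p).mpr hN
    push_cast at this
    exact this
  have ha' : (a : ZMod p) ≠ 0 := by rwa [Ne, ZMod.intCast_zmod_eq_zero_iff_dvd]
  have h6 : (6 : ZMod p) ≠ 0 := by
    intro h0
    have h1 : p ∣ 6 := (ZMod.natCast_eq_zero_iff 6 p).mp (by exact_mod_cast h0)
    rw [show 6 = 2 * 3 from rfl, hp.dvd_mul, Nat.prime_dvd_prime_iff_eq hp Nat.prime_two,
      Nat.prime_dvd_prime_iff_eq hp Nat.prime_three] at h1
    tauto
  refine ⟨z / (6 * (a : ZMod p) ^ 3), ?_⟩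
  field_simp
  push_cast
  linear_combination hz - 6 * (e : ZMod p) * (a : ZMod p) ^ 3 * (b + 3 * a) * hN'

instance : Fact (Nat.Prime 7) := ⟨by norm_num⟩

theorem three_dvd_of_isotropicPair_pencil {a b : ℤ} {v w : Fin 5 → ℤ}
    (h : IsotropicPair (pencil a b) v w) {i j : Fin 5} (hij : v i * w j - v j * w i ≠ 0) :
    (3 : ℤ) ∣ b := by
  by_contra hb
  have hb' : (b : ZMod 3) ≠ 0 := by
    rw [Ne, ZMod.intCast_zmod_eq_zero_iff_dvd]; exact_mod_cast hb
  let M : Matrix (Fin 5) (Fin 5) ℤ :=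
    !![-7 * a, 7 * b, 0, 0, 0;
       7 * b, 21 * a, 0, 0, 0;
       0, 0, 6 * a + b, -b, 3 * a;
       0, 0, -b, -b, -3 * a;
       0, 0, 3 * a, -3 * a, -3 * b]
  let L : Matrix (Fin 5) (Fin 5) ℤ :=
    !![1, 0, 0, 0, 0; 0, 1, 0, 0, 0; 0, 0, 1, 0, 0; 0, 0, 0, 0, 1; 0, 0, 0, 1, 0]
  have hL : Lᵀ * M * L = (1 : ℤ) • pencil a b := by
    ext r s
    fin_cases r <;> fin_cases s <;>
      simp [L, M, pencil, Matrix.mul_apply, Fin.sum_univ_five]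
  have hdet : L.det ≠ 0 := by
    simp [L, Matrix.det_succ_row_zero, Fin.sum_univ_succ, Fin.succAbove]
  obtain ⟨k, l, hkl⟩ := exists_minor_mulVec_ne_zero hdet hij
  have hs : M.IsSymm := by
    ext r s
    fin_cases r <;> fin_cases s <;> simp [M]
  have hr : ∀ r, ((3 : ℕ) : ℤ) ∣ M r 4 := by
    intro r
    fin_cases r <;> simp [M]
  have h9 : ¬ ((3 : ℕ) : ℤ) ^ 2 ∣ M 4 4 := by
    simp only [M]
    intro h0
    simp at h0
    omega
  have hz := (h.mulVec hL).isSquare_det hs hr h9 hkl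
  rw [Matrix.det_succ_row_zero] at hz
  simp [Fin.sum_univ_succ, Matrix.det_fin_three, Fin.succAbove, M] at hz
  generalize (a : ZMod 3) = α at hz
  generalize (b : ZMod 3) = β at hz hb'
  revert α β
  decide

theorem transpose_mul_splitForm_mul (a b n e : ℤ) (hN : b ^ 2 + 3 * a ^ 2 = e ^ 2 * n) :
    let L : Matrix (Fin 5) (Fin 5) ℤ :=
      !![a, -b, 0, 0, 0; 0, 0, 1, 0, 0; 0, 0, 0, 1, 0; 0, 0, 0, 0, 1; 0, e, 0, 0, 0]
    Lᵀ * splitForm a b (-7) (7 * n) * L = a • pencil a b := by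
  intro L
  ext r s
  fin_cases r <;> fin_cases s <;>
    simp [L, splitForm, pencil, Matrix.mul_apply, Fin.sum_univ_five] <;>
    first | done | ring1 | linear_combination (-7) * hN

theorem isSquare_prime_of_isotropicPair_pencil {a b : ℤ} {v w : Fin 5 → ℤ}
    (h : IsotropicPair (pencil a b) v w) {i j : Fin 5} (hij : v i * w j - v j * w i ≠ 0)
    {p : ℕ} (hp : p.Prime) (h2 : p ≠ 2) (h3 : p ≠ 3) (h7 : p ≠ 7) (ha : ¬ (p : ℤ) ∣ a)
    {k : ℕ} {n : ℤ} (hn : ¬ (p : ℤ) ∣ n) (hN : b ^ 2 + 3 * a ^ 2 = (p : ℤ) ^ (2 * k + 1) * n) :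
    IsSquare (p : ZMod 7) := by
  have : Fact p.Prime := ⟨hp⟩
  have hpp : Prime (p : ℤ) := Nat.prime_iff_prime_int.mp hp
  have hL := transpose_mul_splitForm_mul a b (p * n) ((p : ℤ) ^ k) (by rw [hN]; ring)
  have hdet : (!![a, -b, 0, 0, 0; 0, 0, 1, 0, 0; 0, 0, 0, 1, 0; 0, 0, 0, 0, 1;
      0, (p : ℤ) ^ k, 0, 0, 0] : Matrix (Fin 5) (Fin 5) ℤ).det ≠ 0 := by
    have ha0 : a ≠ 0 := by rintro rfl; simp at ha
    rw [Matrix.det_succ_column_zero]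
    simp [Fin.sum_univ_succ, Matrix.det_succ_row_zero, Fin.succAbove, ha0, hp.ne_zero]
  obtain ⟨r, s, hrs⟩ := exists_minor_mulVec_ne_zero hdet hij
  have h7p : ¬ (p : ℤ) ∣ 7 := by
    intro h0
    exact h7 ((Nat.prime_dvd_prime_iff_eq hp (by norm_num)).mp (by exact_mod_cast h0))
  have hpN : (p : ℤ) ∣ b ^ 2 + 3 * a ^ 2 := by
    rw [hN]; exact (dvd_pow_self _ (by omega)).mul_right _
  have hsq : IsSquare ((-3 * -7 : ℤ) : ZMod p) := by
    refine isSquare_of_isotropicPair_splitForm h2 h3 ha hpN ((dvd_mul_right _ _).mul_left 7) ?_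
      (h.mulVec hL) hrs
    intro h0
    rw [sq, show 7 * ((p : ℤ) * n) = p * (7 * n) by ring] at h0
    exact (hpp.dvd_or_dvd ((mul_dvd_mul_iff_left hpp.ne_zero).mp h0)).elim h7p hn
  have hneg : IsSquare (-7 : ZMod p) := by
    obtain ⟨z, hz⟩ := hsq
    have hN' : (b : ZMod p) ^ 2 + 3 * (a : ZMod p) ^ 2 = 0 := by
      have := (ZMod.intCast_zmod_eq_zero_iff_dvd _ p).mpr hpN
      push_cast at this
      exact this
    have ha' : (a : ZMod p) ≠ 0 := by rwa [Ne, ZMod.intCast_zmod_eq_zero_iff_dvd]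
    have h3' : (3 : ZMod p) ≠ 0 := by
      intro h0
      have h1 : p ∣ 3 := (ZMod.natCast_eq_zero_iff 3 p).mp (by exact_mod_cast h0)
      exact h3 ((Nat.prime_dvd_prime_iff_eq hp Nat.prime_three).mp h1)
    refine ⟨z * b / (3 * a), ?_⟩
    field_simp
    push_cast at hz
    linear_combination (b : ZMod p) ^ 2 * hz - 21 * hN'
  have h70 : (7 : ZMod p) ≠ 0 := by
    intro h0
    apply h7p
    have := (ZMod.intCast_zmod_eq_zero_iff_dvd 7 p).mp (by exact_mod_cast h0)
    exact_mod_cast this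
  have hodd : p % 2 = 1 := hp.eq_two_or_odd.resolve_left h2
  rcases (by omega : p % 4 = 1 ∨ p % 4 = 3) with h4 | h4
  · refine (ZMod.exists_sq_eq_prime_iff_of_mod_four_eq_one h4 (q := 7) (by norm_num)).mp ?_
    have hm1 : IsSquare (-1 : ZMod p) := ZMod.exists_sq_eq_neg_one_iff.mpr (by omega)
    simpa using hm1.mul hneg
  · by_contra hc
    have h7sq := (ZMod.exists_sq_eq_prime_iff_of_mod_four_eq_three h4 (q := 7) (by norm_num) h7).mpr hc
    have : IsSquare (-1 : ZMod p) := by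
      have := hneg.div h7sq
      rwa [Nat.cast_ofNat, neg_div, div_self h70] at this
    exact ZMod.exists_sq_eq_neg_one_iff.mp this h4

theorem isSquare_seven_of_isotropicPair_pencil {a b : ℤ} {v w : Fin 5 → ℤ}
    (h : IsotropicPair (pencil a b) v w) {i j : Fin 5} (hij : v i * w j - v j * w i ≠ 0)
    {k : ℕ} {n : ℤ} (hN : b ^ 2 + 3 * a ^ 2 = 7 ^ k * n)
    (hab : IsCoprime a b) :
    IsSquare (n : ZMod 7) := by
  have hpp : Prime (7 : ℤ) := by norm_num
  have ha : k = 0 ∨ ¬ (7 : ℤ) ∣ a := by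
    by_contra! hc
    have h1 : (7 : ℤ) ∣ b ^ 2 := by
      rw [show b ^ 2 = 7 ^ k * n - a * (3 * a) by linear_combination hN]
      exact dvd_sub ((dvd_pow_self _ hc.1).mul_right _) (hc.2.mul_right _)
    exact hpp.not_isUnit (hab.isUnit_of_dvd' hc.2 (hpp.dvd_of_dvd_pow h1))
  by_cases ha7 : (7 : ℤ) ∣ a
  · have hk : k = 0 := ha.resolve_right (not_not.mpr ha7)
    subst hk
    have ha' : (a : ZMod 7) = 0 := (ZMod.intCast_zmod_eq_zero_iff_dvd a 7).mpr (by exact_mod_cast ha7)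
    refine ⟨b, ?_⟩
    have := congrArg (Int.cast : ℤ → ZMod 7) hN
    push_cast at this
    rw [ha'] at this
    linear_combination -this
  have ha0 : a ≠ 0 := by rintro rfl; simp at ha7
  have ha' : (a : ZMod 7) ≠ 0 := by
    rw [Ne, ZMod.intCast_zmod_eq_zero_iff_dvd]; exact_mod_cast ha7
  rcases Nat.even_or_odd' k with ⟨m, rfl | rfl⟩
  · let M : Matrix (Fin 5) (Fin 5) ℤ :=
      !![a * (6 * a + b), a * (3 * a), a * (-b), 0, 0;
         a * (3 * a), a * (-3 * b), a * (-3 * a), 0, 0;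
         a * (-b), a * (-3 * a), a * (-b), 0, 0;
         0, 0, 0, -(7 : ℕ), 0;
         0, 0, 0, 0, (7 : ℕ) * n]
    let L : Matrix (Fin 5) (Fin 5) ℤ :=
      !![0, 0, 1, 0, 0; 0, 0, 0, 1, 0; 0, 0, 0, 0, 1; a, -b, 0, 0, 0; 0, 7 ^ m, 0, 0, 0]
    have hL : Lᵀ * M * L = a • pencil a b := by
      ext r s
      fin_cases r <;> fin_cases s <;>
        simp [L, M, pencil, Matrix.mul_apply, Fin.sum_univ_five] <;>
        first | done | ring1 | linear_combination (-7) * hN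
    have hdet : L.det ≠ 0 := by
      rw [Matrix.det_succ_column_zero]
      simp [L, Fin.sum_univ_succ, Matrix.det_succ_row_zero, Fin.succAbove, ha0]
    obtain ⟨r, s, hrs⟩ := exists_minor_mulVec_ne_zero hdet hij
    have hs : M.IsSymm := by
      ext r s
      fin_cases r <;> fin_cases s <;> simp [M]
    refine (h.mulVec hL).isSquare_of_ternary hs (fun i => by fin_cases i <;> simp [M])
      (fun i => by fin_cases i <;> simp [M]) rfl rfl rfl ?_ hrs
    rw [Matrix.det_fin_three]
    simp [M]
    generalize (a : ZMod 7) = α at ha'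
    generalize (b : ZMod 7) = β
    revert α β
    decide
  · let L : Matrix (Fin 5) (Fin 5) ℤ :=
      !![0, 7 ^ (m + 1), 0, 0, 0; 0, 0, 1, 0, 0; 0, 0, 0, 1, 0; 0, 0, 0, 0, 1; a, -b, 0, 0, 0]
    have hL : Lᵀ * splitForm a b n (-7) * L = a • pencil a b := by
      ext r s
      fin_cases r <;> fin_cases s <;>
        simp [L, splitForm, pencil, Matrix.mul_apply, Fin.sum_univ_five] <;>
        first | done | ring1 | linear_combination (-7) * hN
    have hdet : L.det ≠ 0 := by
      rw [Matrix.det_succ_column_zero]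
      simp [L, Fin.sum_univ_succ, Matrix.det_succ_row_zero, Fin.succAbove, ha0]
    obtain ⟨r, s, hrs⟩ := exists_minor_mulVec_ne_zero hdet hij
    have hsq : IsSquare ((-3 * n : ℤ) : ZMod 7) := by
      refine isSquare_of_isotropicPair_splitForm (by norm_num) (by norm_num)
        (by exact_mod_cast ha7) ?_ (f := -7) (by norm_num) (by norm_num) (h.mulVec hL) hrs
      rw [hN]
      exact_mod_cast (dvd_pow_self (7 : ℤ) (by omega)).mul_right n
    push_cast at hsq
    generalize (n : ZMod 7) = ν at hsq
    revert ν
    decide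

theorem isSquare_natCast_zmod_seven {m : ℕ} (hm : m ≠ 0)
    (h : ∀ p, p.Prime → Odd (m.factorization p) → IsSquare (p : ZMod 7)) :
    IsSquare (m : ZMod 7) := by
  rw [← Nat.prod_factorization_pow_eq_self hm, Finsupp.prod, Nat.cast_prod]
  refine Finset.prod_induction _ IsSquare (fun _ _ => IsSquare.mul) IsSquare.one fun p hp => ?_
  rw [Nat.cast_pow]
  rcases Nat.even_or_odd (m.factorization p) with he | ho
  · exact he.isSquare_pow _
  · exact (h p (Nat.prime_of_mem_primeFactors hp) ho).pow _

/-- No member of the pencil contains a rational line. -/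
theorem not_isotropicPair_pencil {a b : ℤ} (hab : IsCoprime a b) {v w : Fin 5 → ℤ}
    (h : IsotropicPair (pencil a b) v w) {i j : Fin 5} (hij : v i * w j - v j * w i ≠ 0) :
    False := by
  obtain ⟨c, rfl⟩ := three_dvd_of_isotropicPair_pencil h hij
  have h3a : ¬ (3 : ℤ) ∣ a := fun h0 =>
    (by norm_num : Prime (3 : ℤ)).not_isUnit (hab.isUnit_of_dvd' h0 (dvd_mul_right _ _))
  obtain ⟨N, hN⟩ : ∃ N : ℕ, (N : ℤ) = a ^ 2 + 3 * c ^ 2 :=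
    ⟨(a ^ 2 + 3 * c ^ 2).toNat, Int.toNat_of_nonneg (by positivity)⟩
  have hN0 : N ≠ 0 := by
    rintro rfl
    rw [Nat.cast_zero] at hN
    have : a ^ 2 = 0 := by nlinarith [sq_nonneg a, sq_nonneg c]
    rw [pow_eq_zero_iff two_ne_zero] at this
    simp [this] at h3a
  obtain ⟨k, m, h7m, hNm⟩ := Nat.exists_eq_pow_mul_and_not_dvd hN0 7 (by norm_num)
  have hm0 : m ≠ 0 := by rintro rfl; simp at h7m
  have hNm' : (3 * c) ^ 2 + 3 * a ^ 2 = 3 * (7 ^ k * (m : ℤ)) := by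
    have : ((7 ^ k * m : ℕ) : ℤ) = a ^ 2 + 3 * c ^ 2 := by rw [← hNm, hN]
    push_cast at this
    linear_combination -3 * this
  have hmsq : IsSquare (m : ZMod 7) := by
    refine isSquare_natCast_zmod_seven hm0 fun p hp ho => ?_
    have hpp : Prime (p : ℤ) := Nat.prime_iff_prime_int.mp hp
    obtain ⟨t, ht⟩ := ho
    have hpm : p ∣ m := Nat.dvd_of_factorization_pos (by omega)
    by_cases h2 : p = 2
    · subst h2; decide
    have h7 : p ≠ 7 := by rintro rfl; exact h7m hpm
    have hpN : (p : ℤ) ∣ a ^ 2 + 3 * c ^ 2 := by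
      rw [← hN, hNm]; exact_mod_cast hpm.mul_left _
    have h3 : p ≠ 3 := by
      rintro rfl
      apply h3a
      refine (by norm_num : Prime (3 : ℤ)).dvd_of_dvd_pow (n := 2) ?_
      have := dvd_sub hpN (Dvd.intro (c ^ 2) rfl : (3 : ℤ) ∣ 3 * c ^ 2)
      simpa using this
    have h3' : ¬ (p : ℤ) ∣ 3 := by
      intro h0
      exact h3 ((Nat.prime_dvd_prime_iff_eq hp Nat.prime_three).mp (by exact_mod_cast h0))
    have hpa : ¬ (p : ℤ) ∣ a := by
      intro h0
      have h1 : (p : ℤ) ∣ 3 * c ^ 2 := by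
        have := dvd_sub hpN (h0.mul_right a)
        rwa [show a ^ 2 + 3 * c ^ 2 - a * a = 3 * c ^ 2 by ring] at this
      have h4 := hpp.dvd_of_dvd_pow ((hpp.dvd_or_dvd h1).resolve_left h3')
      exact hpp.not_isUnit (hab.isUnit_of_dvd' h0 (h4.mul_left 3))
    have hnd := Nat.not_dvd_ordCompl hp hm0
    have hmul := Nat.ordProj_mul_ordCompl_eq_self m p
    set q := m / p ^ m.factorization p with hq
    rw [ht] at hmul
    refine isSquare_prime_of_isotropicPair_pencil h hij hp h2 h3 h7 hpa (k := t)
      (n := 3 * 7 ^ k * q) ?_ ?_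
    · intro h0
      rcases hpp.dvd_or_dvd h0 with h1 | h1
      · rcases hpp.dvd_or_dvd h1 with h5 | h5
        · exact h3' h5
        · have h6 := hpp.dvd_of_dvd_pow h5
          exact h7 ((Nat.prime_dvd_prime_iff_eq hp (by norm_num)).mp (by exact_mod_cast h6))
      · exact hnd (by exact_mod_cast h1)
    · rw [hNm', ← hmul]
      push_cast
      ring
  have h3m : IsSquare ((3 * m : ℤ) : ZMod 7) := by
    exact isSquare_seven_of_isotropicPair_pencil h hij (k := k) (by rw [hNm']; ring) hab
  have hm7 : (m : ZMod 7) ≠ 0 := by rwa [Ne, ZMod.natCast_eq_zero_iff]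
  push_cast at h3m
  generalize (m : ZMod 7) = μ at hmsq h3m hm7
  revert μ
  decide

theorem exists_isCoprime_mul_add_mul_eq_zero (r s : ℚ) :
    ∃ a b : ℤ, IsCoprime a b ∧ a * r + b * s = 0 := by
  by_cases hr : r = 0
  · exact ⟨1, 0, isCoprime_one_left, by simp [hr]⟩
  · refine ⟨-(s / r).num, (s / r).den, (Rat.isCoprime_num_den _).neg_left, ?_⟩
    have h : ((s / r).num : ℚ) = s / r * (s / r).den := (Rat.mul_den_eq_num _).symm
    push_cast
    rw [h]
    field_simp
    ring

theorem exists_int_multiple {n : ℕ} (v : Fin n → ℚ) :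
    ∃ d : ℤ, d ≠ 0 ∧ ∃ v' : Fin n → ℤ, ∀ i, (v' i : ℚ) = d * v i := by
  obtain ⟨⟨d, hd⟩, h⟩ := IsLocalization.exist_integer_multiples_of_finite (nonZeroDivisors ℤ) v
  choose v' hv' using h
  refine ⟨d, nonZeroDivisors.ne_zero hd, v', fun i => ?_⟩
  simpa using hv' i

/-- No two independent rational vectors `v`, `w` are such that `Q₀` and `Q∞` restrict to
proportional forms on the plane they span. -/
theorem minor_eq_zero_of_proportional {v w : Fin 5 → ℚ} {s t : ℚ}
    (h0 : Q0 v = s * Q0 w) (hinf : Qinf v = s * Qinf w)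
    (h0' : Q0 (v + w) = t * Q0 w) (hinf' : Qinf (v + w) = t * Qinf w) (i j : Fin 5) :
    v i * w j - v j * w i = 0 := by
  by_contra hij
  obtain ⟨a, b, hab, hw⟩ := exists_isCoprime_mul_add_mul_eq_zero (Q0 w) (Qinf w)
  have hv : a * Q0 v + b * Qinf v = 0 := by rw [h0, hinf]; linear_combination s * hw
  have hvw : a * Q0 (v + w) + b * Qinf (v + w) = 0 := by
    rw [h0', hinf']; linear_combination t * hw
  obtain ⟨d, hd, v', hv'⟩ := exists_int_multiple v
  obtain ⟨e, he, w', hw'⟩ := exists_int_multiple w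
  simp only [Q0, Qinf, Pi.add_apply] at hw hv hvw
  refine not_isotropicPair_pencil hab (v := v') (w := w') (i := i) (j := j) ?_ ?_
  · refine ⟨?_, ?_, ?_, ?_⟩ <;> rw [← Int.cast_inj (α := ℚ)] <;>
      simp [dotProduct, Matrix.mulVec, Fin.sum_univ_five, pencil, hv', hw']
    · linear_combination (d : ℚ) ^ 2 * hv
    · linear_combination (d * e / 2 : ℚ) * (hvw - hv - hw)
    · linear_combination (d * e / 2 : ℚ) * (hvw - hv - hw)
    · linear_combination (e : ℚ) ^ 2 * hw
  · intro h
    have h' := congrArg (Int.cast : ℤ → ℚ) h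
    push_cast at h'
    rw [hv', hv', hw', hw'] at h'
    have : (d * e : ℚ) * (v i * w j - v j * w i) = 0 := by linear_combination h'
    simp [hd, he, hij] at this

theorem eq_zero_of_rat {v : Fin 5 → ℚ} (h0 : Q0 v = 0) (hinf : Qinf v = 0) : v = 0 := by
  by_contra hv
  obtain ⟨i, hi⟩ := Function.ne_iff.mp hv
  let f : (Fin 5 → ℚ) →ₗ[ℚ] (Fin 3 → ℚ) := Matrix.mulVecLin
    !![-7 * v 0, 21 * v 1, 6 * v 2 + 3 * v 3, 3 * v 2 - 3 * v 4, -3 * v 3;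
       7 * v 1, 7 * v 0, v 2 - v 4, -3 * v 3, -v 2 - v 4;
       Pi.single (M := fun _ : Fin 5 => ℚ) i 1 0, Pi.single (M := fun _ : Fin 5 => ℚ) i 1 1,
       Pi.single (M := fun _ : Fin 5 => ℚ) i 1 2, Pi.single (M := fun _ : Fin 5 => ℚ) i 1 3,
       Pi.single (M := fun _ : Fin 5 => ℚ) i 1 4]
  have hker : LinearMap.ker f ≠ ⊥ := LinearMap.ker_ne_bot_of_finrank_lt (by simp)
  obtain ⟨w, hw, hw0⟩ := (Submodule.ne_bot_iff _).mp hker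
  rw [LinearMap.mem_ker] at hw
  have hp0 := congrFun hw 0
  have hpinf := congrFun hw 1
  have hwi := congrFun hw 2
  simp [f, dotProduct, Matrix.mulVec, Fin.sum_univ_five] at hp0 hpinf hwi
  have hwi' : w i = 0 := by
    fin_cases i <;> simpa using hwi
  apply hw0
  ext j
  have := minor_eq_zero_of_proportional (v := v) (w := w) (s := 0) (t := 1)
    (by rw [h0]; ring) (by rw [hinf]; ring)
    (by simp only [Q0, Pi.add_apply] at h0 ⊢; linear_combination h0 + 2 * hp0)
    (by simp only [Qinf, Pi.add_apply] at hinf ⊢; linear_combination hinf + 2 * hpinf) i j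
  rw [hwi', mul_zero, sub_zero] at this
  exact (mul_eq_zero.mp this).resolve_left hi

theorem exists_rat_coordinates {K : Type*} [Field K] [Algebra ℚ K] [FiniteDimensional ℚ K]
    (hK : Module.finrank ℚ K ≤ 2) {θ : K} (hθ : ∀ q : ℚ, algebraMap ℚ K q ≠ θ) (y : K) :
    ∃ r s : ℚ, y = algebraMap ℚ K r + algebraMap ℚ K s * θ := by
  have hli : LinearIndependent ℚ ![(1 : K), θ] := by
    rw [LinearIndependent.pair_iff' one_ne_zero]
    intro q hq
    exact hθ q (by rw [← hq, Algebra.algebraMap_eq_smul_one])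
  have hcard : Fintype.card (Fin 2) = Module.finrank ℚ K :=
    le_antisymm hli.fintype_card_le_finrank (by simpa using hK)
  have hspan := hli.span_eq_top_of_card_eq_finrank' hcard
  have hy : y ∈ Submodule.span ℚ (Set.range ![(1 : K), θ]) := by rw [hspan]; trivial
  rw [Matrix.range_cons, Matrix.range_cons, Matrix.range_empty, Set.union_empty,
    Set.singleton_union, Submodule.mem_span_pair] at hy
  obtain ⟨r, s, hrs⟩ := hy
  exact ⟨r, s, by rw [← hrs, Algebra.smul_def, Algebra.smul_def, mul_one]⟩

/-- The quartic del Pezzo surface `X₋₇ = V(Q₀) ∩ V(Q∞)` has no closed points of degree 1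
or 2: for every field `K` with a `ℚ`-algebra structure of dimension at most 2, the forms
`Q₀` and `Q∞` have no common nonzero zero in `K⁵`. -/
theorem stmt12 :
    ∀ (K : Type) [Field K] [Algebra ℚ K] [FiniteDimensional ℚ K],
      Module.finrank ℚ K ≤ 2 →
        ∀ x : Fin 5 → K, Q0 x = 0 → Qinf x = 0 → x = 0 := by
  intro K _ _ _ hK x h0 hinf
  by_contra hx
  obtain ⟨i, hi⟩ := Function.ne_iff.mp hx
  rw [Pi.zero_apply] at hi
  obtain ⟨y, hyi, hy0, hyinf⟩ : ∃ y : Fin 5 → K, y i = 1 ∧ Q0 y = 0 ∧ Qinf y = 0 := by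
    refine ⟨(x i)⁻¹ • x, by simp [hi], ?_, ?_⟩
    · simp only [Q0, Pi.smul_apply, smul_eq_mul] at h0 ⊢
      linear_combination (x i)⁻¹ ^ 2 * h0
    · simp only [Qinf, Pi.smul_apply, smul_eq_mul] at hinf ⊢
      linear_combination (x i)⁻¹ ^ 2 * hinf
  have hinj := FaithfulSMul.algebraMap_injective ℚ K
  by_cases hrat : ∀ j, ∃ q : ℚ, algebraMap ℚ K q = y j
  · choose v hv using hrat
    have hv0 : v = 0 := by
      apply eq_zero_of_rat <;> apply hinj
      · rw [map_zero, ← hy0]; simp only [Q0, ← hv, map_add, map_sub, map_mul, map_pow, map_neg, map_ofNat]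
      · rw [map_zero, ← hyinf]; simp only [Qinf, ← hv, map_add, map_sub, map_mul, map_pow, map_ofNat]
    have := hv i
    simp [hv0, hyi] at this
  push Not at hrat
  obtain ⟨j, hj⟩ := hrat
  set θ := y j with hθ
  choose v w hvw using fun l => exists_rat_coordinates hK hj (y l)
  have huniq : ∀ r s : ℚ, algebraMap ℚ K r + algebraMap ℚ K s * θ = 0 → r = 0 ∧ s = 0 := by
    intro r s hrs
    have hs : s = 0 := by
      by_contra hs
      apply hj (-r / s)
      have : algebraMap ℚ K s ≠ 0 := (map_ne_zero _).mpr hs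
      rw [map_div₀, map_neg]
      field_simp
      linear_combination -hrs
    refine ⟨?_, hs⟩
    apply hinj
    simpa [hs] using hrs
  obtain ⟨α, β, hsq⟩ := exists_rat_coordinates hK hj (θ ^ 2)
  have e0 := huniq (Q0 v + α * Q0 w) (Q0 (v + w) - Q0 v - Q0 w + β * Q0 w) (by
    rw [← hy0]
    simp only [Q0, hvw, Pi.add_apply]
    simp only [map_add, map_sub, map_mul, map_pow, map_neg, map_ofNat]
    linear_combination (-(-7 * (algebraMap ℚ K (w 0) ^ 2 - 3 * algebraMap ℚ K (w 1) ^ 2)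
      + 6 * algebraMap ℚ K (w 2) ^ 2 + 6 * algebraMap ℚ K (w 2) * algebraMap ℚ K (w 3)
      - 6 * algebraMap ℚ K (w 3) * algebraMap ℚ K (w 4))) * hsq)
  have einf := huniq (Qinf v + α * Qinf w) (Qinf (v + w) - Qinf v - Qinf w + β * Qinf w) (by
    rw [← hyinf]
    simp only [Qinf, hvw, Pi.add_apply]
    simp only [map_add, map_sub, map_mul, map_pow, map_ofNat]
    linear_combination (-(14 * algebraMap ℚ K (w 0) * algebraMap ℚ K (w 1) + algebraMap ℚ K (w 2) ^ 2
      - 2 * algebraMap ℚ K (w 2) * algebraMap ℚ K (w 4) - 3 * algebraMap ℚ K (w 3) ^ 2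
      - algebraMap ℚ K (w 4) ^ 2)) * hsq)
  have hi' := huniq (v i - 1) (w i) (by
    have := hvw i
    rw [hyi] at this
    rw [map_sub, map_one]; linear_combination -this)
  have hj' := huniq (v j) (w j - 1) (by
    have := hvw j
    rw [map_sub, map_one]; linear_combination -this)
  have hmin := minor_eq_zero_of_proportional (v := v) (w := w) (s := -α) (t := 1 - α - β)
    (by linear_combination e0.1) (by linear_combination einf.1)
    (by linear_combination e0.2 + e0.1) (by linear_combination einf.2 + einf.1) i j
  rw [sub_eq_zero.mp hi'.1, hi'.2, sub_eq_zero.mp hj'.2, hj'.1] at hmin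
  norm_num at hmin
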